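/- If f : (ℝ² \ {0}) × (0,∞) → ℝ is positively homogeneous of degree −2 and continuous, then for any two piecewise C¹ closed curves γ₁, γ₂ in ℝ² \ {0} each winding once around the origin, ∫_{γ₁} f(x,0⁺)(x·ν) ds = ∫_{γ₂} f(x,0⁺)(x·ν) ds, where f(x,0⁺) = lim_{h→0⁺} f(x,h) (assumed to exist and be continuous on ℝ²\{0}), i.e., the residue Res(f) is path independent. -/

import Mathlib

open Real Filter intervalIntegral

/-- The one-sided limit of a positively homogeneous function of degree `-2` is positively
homogeneous of degree `-2`. -/
theorem limit_homogeneous {f : ℝ × ℝ → ℝ → ℝ} {g : ℝ × ℝ → ℝ}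
    (hhom : ∀ lam : ℝ, 0 < lam → ∀ x : ℝ × ℝ, x ≠ 0 → ∀ h : ℝ, 0 < h →
      f (lam • x) (lam * h) = lam ^ (-2 : ℤ) * f x h)
    (hfg : ∀ x : ℝ × ℝ, x ≠ 0 →
      Tendsto (fun h => f x h) (nhdsWithin 0 (Set.Ioi 0)) (nhds (g x)))
    {lam : ℝ} (hlam : 0 < lam) {x : ℝ × ℝ} (hx : x ≠ 0) :
    g (lam • x) = lam ^ (-2 : ℤ) * g x := by
  have hscale : Tendsto (fun h : ℝ => lam * h) (nhdsWithin 0 (Set.Ioi 0))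
      (nhdsWithin 0 (Set.Ioi 0)) := by
    refine tendsto_nhdsWithin_iff.2 ⟨?_, ?_⟩
    · have : Tendsto (fun h : ℝ => lam * h) (nhds 0) (nhds (lam * 0)) :=
        (continuous_const_mul lam).tendsto 0
      rw [mul_zero] at this
      exact this.mono_left nhdsWithin_le_nhds
    · filter_upwards [self_mem_nhdsWithin] with h hh using mul_pos hlam hh
  refine tendsto_nhds_unique ((hfg _ (smul_ne_zero hlam.ne' hx)).comp hscale) ?_
  refine ((hfg x hx).const_mul (lam ^ (-2 : ℤ))).congr' ?_
  filter_upwards [self_mem_nhdsWithin] with h hh using (hhom lam hlam x hx h hh).symm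

theorem sq_add_sq_pos {p : ℝ × ℝ} (hp : p ≠ 0) : 0 < p.1 ^ 2 + p.2 ^ 2 := by
  by_contra! h
  exact hp (Prod.ext (pow_eq_zero_iff two_ne_zero |>.1 (by nlinarith [sq_nonneg p.1, sq_nonneg p.2]))
    (pow_eq_zero_iff two_ne_zero |>.1 (by nlinarith [sq_nonneg p.1, sq_nonneg p.2])))

/-- A plane curve avoiding the origin, with integrable angular velocity, has a continuous polar
angle which is a primitive of the angular velocity. -/
theorem exists_polar_angle {γ γ' : ℝ → ℝ × ℝ} {s : Set ℝ} (hs : s.Finite)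
    (hc : ContinuousOn γ (Set.Icc 0 1)) (h0 : ∀ t ∈ Set.Icc (0:ℝ) 1, γ t ≠ 0)
    (hd : ∀ t ∈ Set.Icc (0:ℝ) 1 \ s, HasDerivAt γ (γ' t) t)
    (hc' : ContinuousOn γ' (Set.Icc 0 1 \ s))
    (hi : IntervalIntegrable (fun t => ((γ t).1 * (γ' t).2 - (γ t).2 * (γ' t).1)
      / ((γ t).1 ^ 2 + (γ t).2 ^ 2)) MeasureTheory.volume 0 1) :
    ∃ θ : ℝ → ℝ, ContinuousOn θ (Set.Icc 0 1) ∧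
      (∀ t ∈ Set.Ioo (0:ℝ) 1 \ s, HasDerivAt θ (((γ t).1 * (γ' t).2 - (γ t).2 * (γ' t).1)
        / ((γ t).1 ^ 2 + (γ t).2 ^ 2)) t) ∧
      ∀ t ∈ Set.Icc (0:ℝ) 1, γ t = √((γ t).1 ^ 2 + (γ t).2 ^ 2) • (cos (θ t), sin (θ t)) := by
  set k : ℝ → ℝ := fun t => ((γ t).1 * (γ' t).2 - (γ t).2 * (γ' t).1)
      / ((γ t).1 ^ 2 + (γ t).2 ^ 2) with hk
  set r : ℝ → ℝ := fun t => (γ t).1 ^ 2 + (γ t).2 ^ 2 with hr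
  have hrpos : ∀ t ∈ Set.Icc (0:ℝ) 1, 0 < r t := fun t ht => sq_add_sq_pos (h0 t ht)
  have hrc : ContinuousOn r (Set.Icc 0 1) := (hc.fst.pow 2).add (hc.snd.pow 2)
  set z : ℝ → ℂ := fun t => ((γ t).1 : ℂ) + ((γ t).2 : ℂ) * Complex.I with hz
  have hzc : ContinuousOn z (Set.Icc 0 1) :=
    (Complex.continuous_ofReal.comp_continuousOn hc.fst).add
      ((Complex.continuous_ofReal.comp_continuousOn hc.snd).mul continuousOn_const)
  have hznorm : ∀ t, ‖z t‖ = √(r t) := fun t => Complex.norm_add_mul_I _ _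
  set θ : ℝ → ℝ := fun t => Complex.arg (z 0) + ∫ u in (0:ℝ)..t, k u with hθ
  have hθc : ContinuousOn θ (Set.Icc 0 1) := by
    refine continuousOn_const.add ?_
    have := continuousOn_primitive_interval' hi (Set.left_mem_uIcc)
    rwa [Set.uIcc_of_le zero_le_one] at this
  have hopen : IsOpen (Set.Ioo (0:ℝ) 1 \ s) := isOpen_Ioo.sdiff hs.isClosed
  have hsub : Set.Ioo (0:ℝ) 1 \ s ⊆ Set.Icc 0 1 \ s :=
    Set.sdiff_subset_sdiff_left Set.Ioo_subset_Icc_self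
  have hkc : ContinuousOn k (Set.Ioo (0:ℝ) 1 \ s) := by
    have h1 := hc.mono (hsub.trans Set.sdiff_subset)
    have h2 := hc'.mono hsub
    exact ((h1.fst.mul h2.snd).sub (h1.snd.mul h2.fst)).div
      (hrc.mono (hsub.trans Set.sdiff_subset)) fun t ht => (hrpos t (hsub ht).1).ne'
  have hθd : ∀ t ∈ Set.Ioo (0:ℝ) 1 \ s, HasDerivAt θ (k t) t := by
    intro t ht
    refine HasDerivAt.const_add _ (integral_hasDerivAt_right ?_
      (hkc.stronglyMeasurableAtFilter hopen t ht) (hkc.continuousAt (hopen.mem_nhds ht)))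
    refine hi.mono_set ?_
    rw [Set.uIcc_of_le ht.1.1.le, Set.uIcc_of_le zero_le_one]
    exact Set.Icc_subset_Icc_right ht.1.2.le
  set L : ℝ → ℂ := fun t => ((Real.log (r t) / 2 : ℝ) : ℂ) + (θ t : ℂ) * Complex.I with hL
  have hLc : ContinuousOn L (Set.Icc 0 1) :=
    (Complex.continuous_ofReal.comp_continuousOn
      ((hrc.log fun t ht => (hrpos t ht).ne').div_const 2)).add
      ((Complex.continuous_ofReal.comp_continuousOn hθc).mul continuousOn_const)
  have hexpL : ∀ t ∈ Set.Icc (0:ℝ) 1,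
      Complex.exp (L t) = (√(r t) : ℂ) * (Complex.cos (θ t) + Complex.sin (θ t) * Complex.I) := by
    intro t ht
    rw [hL, Complex.exp_add, Complex.exp_mul_I, ← Complex.ofReal_exp, ← Real.log_sqrt
      (hrpos t ht).le, Real.exp_log (Real.sqrt_pos.2 (hrpos t ht))]
  have hderiv : ∀ t ∈ Set.Ioo (0:ℝ) 1 \ s,
      HasDerivAt (fun t => z t * Complex.exp (-L t)) 0 t := by
    intro t ht
    have hγ := hd t (hsub ht)
    have hx : HasDerivAt (fun t => (γ t).1) (γ' t).1 t := hγ.fst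
    have hy : HasDerivAt (fun t => (γ t).2) (γ' t).2 t := hγ.snd
    have hrt := (hrpos t (hsub ht).1).ne'
    have hzd := hx.ofReal_comp.add (hy.ofReal_comp.mul_const Complex.I)
    have hrd : HasDerivAt r _ t := (hx.pow 2).add (hy.pow 2)
    have hLd := ((hrd.log hrt).div_const 2).ofReal_comp.add
      ((hθd t ht).ofReal_comp.mul_const Complex.I)
    have := hzd.mul hLd.neg.cexp
    refine this.congr_deriv ?_
    have key : ∀ x y a b e : ℂ, x ^ 2 + y ^ 2 ≠ 0 →
        (a + b * Complex.I) * e + (x + y * Complex.I) * (e * -((2 * x * a + 2 * y * b)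
          / (x ^ 2 + y ^ 2) / 2 + (x * b - y * a) / (x ^ 2 + y ^ 2) * Complex.I)) = 0 := by
      intro x y a b e h
      field_simp
      ring_nf
      simp only [Complex.I_sq]
      ring
    have hne : ((γ t).1 : ℂ) ^ 2 + ((γ t).2 : ℂ) ^ 2 ≠ 0 := by exact_mod_cast hrt
    have := key (γ t).1 (γ t).2 (γ' t).1 (γ' t).2 (Complex.exp (-L t)) hne
    simpa [hk, hr, hL] using this
  have hz0 : z 0 ≠ 0 := by
    rw [← norm_pos_iff, hznorm]
    exact Real.sqrt_pos.2 (hrpos 0 (by simp))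
  have hL0 : L 0 = Complex.log (z 0) := by
    rw [Complex.log, hznorm, Real.log_sqrt (hrpos 0 (by simp)).le]
    simp [hL, hθ]
  refine ⟨θ, hθc, hθd, fun t ht => ?_⟩
  have hconst : z t * Complex.exp (-L t) = z 0 * Complex.exp (-L 0) := by
    have hsubt : Set.Icc 0 t ⊆ Set.Icc (0:ℝ) 1 := Set.Icc_subset_Icc_right ht.2
    have := MeasureTheory.integral_eq_of_hasDerivAt_off_countable_of_le
      (fun t => z t * Complex.exp (-L t)) (fun _ => 0) ht.1 hs.countable
      ((hzc.mul hLc.neg.cexp).mono hsubt)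
      (fun u hu => hderiv u ⟨⟨hu.1.1, hu.1.2.trans_le ht.2⟩, hu.2⟩) (by simp)
    rw [intervalIntegral.integral_zero] at this
    exact (sub_eq_zero.1 this.symm)
  rw [hL0, Complex.exp_neg, Complex.exp_neg, Complex.exp_log hz0, mul_inv_cancel₀ hz0,
    mul_inv_eq_one₀ (Complex.exp_ne_zero _), hexpL t ht] at hconst
  have hre := congrArg Complex.re hconst
  have him := congrArg Complex.im hconst
  rw [← Complex.ofReal_cos, ← Complex.ofReal_sin, Complex.re_ofReal_mul] at hre
  rw [← Complex.ofReal_cos, ← Complex.ofReal_sin, Complex.im_ofReal_mul] at him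
  exact Prod.ext (by simpa [hz, Complex.cos_ofReal_re] using hre)
    (by simpa [hz, Complex.sin_ofReal_re] using him)

/-- The residue integral along a curve winding once around the origin is the integral over the
unit circle. -/
theorem residue_eq_circle_integral {g : ℝ × ℝ → ℝ}
    (hhom : ∀ lam : ℝ, 0 < lam → ∀ x : ℝ × ℝ, x ≠ 0 → g (lam • x) = lam ^ (-2 : ℤ) * g x)
    (hg : ContinuousOn g {x : ℝ × ℝ | x ≠ 0})
    {γ γ' : ℝ → ℝ × ℝ} {s : Set ℝ} (hs : s.Finite)
    (hc : ContinuousOn γ (Set.Icc 0 1)) (h0 : ∀ t ∈ Set.Icc (0:ℝ) 1, γ t ≠ 0)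
    (hd : ∀ t ∈ Set.Icc (0:ℝ) 1 \ s, HasDerivAt γ (γ' t) t)
    (hc' : ContinuousOn γ' (Set.Icc 0 1 \ s))
    (hw : ∫ t in (0:ℝ)..1, ((γ t).1 * (γ' t).2 - (γ t).2 * (γ' t).1)
      / ((γ t).1 ^ 2 + (γ t).2 ^ 2) = 2 * π) :
    ∫ t in (0:ℝ)..1, g (γ t) * ((γ t).1 * (γ' t).2 - (γ t).2 * (γ' t).1)
      = ∫ φ in (0:ℝ)..(2 * π), g (cos φ, sin φ) := by
  have hi : IntervalIntegrable (fun t => ((γ t).1 * (γ' t).2 - (γ t).2 * (γ' t).1)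
      / ((γ t).1 ^ 2 + (γ t).2 ^ 2)) MeasureTheory.volume 0 1 := by
    by_contra h
    rw [integral_undef h] at hw
    exact two_pi_pos.ne hw
  obtain ⟨θ, hθc, hθd, hpolar⟩ := exists_polar_angle hs hc h0 hd hc' hi
  have hne : ∀ φ : ℝ, ((cos φ, sin φ) : ℝ × ℝ) ≠ 0 := by
    intro φ h
    have h1 : cos φ = 0 := congrArg Prod.fst h
    have h2 : sin φ = 0 := congrArg Prod.snd h
    simpa [h1, h2] using sin_sq_add_cos_sq φ
  have hG : Continuous fun φ : ℝ => g (cos φ, sin φ) :=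
    hg.comp_continuous (continuous_cos.prodMk continuous_sin) hne
  have hIcc : Set.uIcc (0:ℝ) 1 = Set.Icc 0 1 := Set.uIcc_of_le zero_le_one
  have hθw : θ 1 = θ 0 + 2 * π := by
    have := MeasureTheory.integral_eq_of_hasDerivAt_off_countable_of_le θ _ zero_le_one
      hs.countable hθc hθd hi
    linarith
  have hcongr : ∫ t in (0:ℝ)..1, g (γ t) * ((γ t).1 * (γ' t).2 - (γ t).2 * (γ' t).1)
      = ∫ t in (0:ℝ)..1, g (cos (θ t), sin (θ t)) *
        (((γ t).1 * (γ' t).2 - (γ t).2 * (γ' t).1) / ((γ t).1 ^ 2 + (γ t).2 ^ 2)) := by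
    refine integral_congr fun t ht => ?_
    rw [hIcc] at ht
    have hr := sq_add_sq_pos (h0 t ht)
    have hgt : g (γ t) = ((γ t).1 ^ 2 + (γ t).2 ^ 2)⁻¹ * g (cos (θ t), sin (θ t)) := by
      conv_lhs => rw [hpolar t ht]
      rw [hhom _ (Real.sqrt_pos.2 hr) _ (hne _), zpow_neg, zpow_ofNat, Real.sq_sqrt hr.le]
    simp only [hgt]
    ring
  have hprim : ∀ x : ℝ, HasDerivAt (fun x => ∫ φ in (0:ℝ)..x, g (cos φ, sin φ))
      (g (cos x, sin x)) x := fun x => hG.integral_hasStrictDerivAt 0 x |>.hasDerivAt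
  have hFTC := MeasureTheory.integral_eq_of_hasDerivAt_off_countable_of_le
    (fun t => ∫ φ in (0:ℝ)..θ t, g (cos φ, sin φ)) _ zero_le_one hs.countable
    ((continuous_iff_continuousAt.2 fun x => (hprim x).continuousAt).comp_continuousOn hθc)
    (fun t ht => (hprim (θ t)).comp t (hθd t ht))
    (hi.continuousOn_mul (hIcc ▸ hG.comp_continuousOn hθc))
  have hper : Function.Periodic (fun φ : ℝ => g (cos φ, sin φ)) (2 * π) := fun φ => by simp
  rw [hcongr, hFTC, integral_interval_sub_left (hG.intervalIntegrable _ _)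
    (hG.intervalIntegrable _ _), hθw]
  simpa using hper.intervalIntegral_add_eq (θ 0) 0

/-- **Path independence of the residue.**
Let `f` be positively homogeneous of degree `−2` with continuous limit
`g(x) = lim_{h→0⁺} f(x,h)` on `ℝ² \ {0}`. For any two piecewise C¹ closed curves in
`ℝ² \ {0}` each winding once around the origin (expressed by the winding-number
integral equalling `2π`), the residue integrals
`∫_γ g(x) (x·ν) ds = ∫₀¹ g(γ t) (γ₁ t γ₂' t − γ₂ t γ₁' t) dt` coincide. -/
theorem residue_path_independent
    (f : ℝ × ℝ → ℝ → ℝ) (g : ℝ × ℝ → ℝ)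
    (hhom : ∀ lam : ℝ, 0 < lam → ∀ x : ℝ × ℝ, x ≠ 0 → ∀ h : ℝ, 0 < h →
      f (lam • x) (lam * h) = lam ^ (-2 : ℤ) * f x h)
    (hg : ContinuousOn g {x : ℝ × ℝ | x ≠ 0})
    (hfg : ∀ x : ℝ × ℝ, x ≠ 0 →
      Tendsto (fun h => f x h) (nhdsWithin 0 (Set.Ioi 0)) (nhds (g x)))
    (γ₁ γ₂ : ℝ → ℝ × ℝ) (γ₁' γ₂' : ℝ → ℝ × ℝ) (s₁ s₂ : Set ℝ)
    (hs₁ : s₁.Finite) (hs₂ : s₂.Finite)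
    -- piecewise C¹ closed curves avoiding the origin
    (hγ₁c : ContinuousOn γ₁ (Set.Icc 0 1)) (hγ₂c : ContinuousOn γ₂ (Set.Icc 0 1))
    (hγ₁cl : γ₁ 0 = γ₁ 1) (hγ₂cl : γ₂ 0 = γ₂ 1)
    (hγ₁0 : ∀ t ∈ Set.Icc (0:ℝ) 1, γ₁ t ≠ 0)
    (hγ₂0 : ∀ t ∈ Set.Icc (0:ℝ) 1, γ₂ t ≠ 0)
    (hγ₁d : ∀ t ∈ Set.Icc (0:ℝ) 1 \ s₁, HasDerivAt γ₁ (γ₁' t) t)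
    (hγ₂d : ∀ t ∈ Set.Icc (0:ℝ) 1 \ s₂, HasDerivAt γ₂ (γ₂' t) t)
    (hγ₁'c : ContinuousOn γ₁' (Set.Icc 0 1 \ s₁))
    (hγ₂'c : ContinuousOn γ₂' (Set.Icc 0 1 \ s₂))
    -- each curve winds once around the origin
    (hw₁ : ∫ t in (0:ℝ)..1,
        ((γ₁ t).1 * (γ₁' t).2 - (γ₁ t).2 * (γ₁' t).1)
          / ((γ₁ t).1 ^ 2 + (γ₁ t).2 ^ 2) = 2 * π)
    (hw₂ : ∫ t in (0:ℝ)..1,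
        ((γ₂ t).1 * (γ₂' t).2 - (γ₂ t).2 * (γ₂' t).1)
          / ((γ₂ t).1 ^ 2 + (γ₂ t).2 ^ 2) = 2 * π) :
    ∫ t in (0:ℝ)..1, g (γ₁ t) * ((γ₁ t).1 * (γ₁' t).2 - (γ₁ t).2 * (γ₁' t).1)
      = ∫ t in (0:ℝ)..1, g (γ₂ t) * ((γ₂ t).1 * (γ₂' t).2 - (γ₂ t).2 * (γ₂' t).1) := by
  have hhom' : ∀ lam : ℝ, 0 < lam → ∀ x : ℝ × ℝ, x ≠ 0 →
      g (lam • x) = lam ^ (-2 : ℤ) * g x :=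
    fun _ hlam _ hx => limit_homogeneous hhom hfg hlam hx
  rw [residue_eq_circle_integral hhom' hg hs₁ hγ₁c hγ₁0 hγ₁d hγ₁'c hw₁,
    residue_eq_circle_integral hhom' hg hs₂ hγ₂c hγ₂0 hγ₂d hγ₂'c hw₂]
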